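/- arXiv:0809.0656 — 2 statements merged into one kernel-verified Lean document; each statement's English description precedes it below -/
import Mathlib

section
/- Let X be a metric space, u : X → ℝ a function, and a < b real numbers. If for every t ∈ [a, b] the function x ↦ e^{itu(x)} is continuous on X, then u is continuous on X. -/
noncomputable section

/-- The continuity of `x ↦ e^{itu(x)}` for `t` in a nontrivial interval propagates to all
`t ≥ 0`. -/
lemma continuous_exp_mul_of_Icc {X : Type*} [TopologicalSpace X] {u : X → ℝ} {a b : ℝ}
    (hab : a < b)
    (h : ∀ t ∈ Set.Icc a b, Continuous fun x => Complex.exp (Complex.I * t * u x))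
    {t : ℝ} (ht : 0 ≤ t) : Continuous fun x => Complex.exp (Complex.I * t * u x) := by
  obtain ⟨n, hn⟩ := exists_nat_gt (t / (b - a))
  have hba : 0 < b - a := sub_pos.2 hab
  have hn0 : (0 : ℝ) < n := lt_of_le_of_lt (by positivity) hn
  have hs : t / n ≤ b - a := by
    rw [div_lt_iff₀ hba] at hn
    rw [div_le_iff₀ hn0]
    linarith
  have hs0 : 0 ≤ t / n := by positivity
  have key := ((h (a + t / n) ⟨by linarith, by linarith⟩).div (h a ⟨le_rfl, hab.le⟩)
    fun x => Complex.exp_ne_zero _).pow n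
  convert key using 2 with x
  have hnC : (n : ℂ) ≠ 0 := by exact_mod_cast hn0.ne'
  rw [Pi.pow_apply, Pi.div_apply, ← Complex.exp_sub, ← Complex.exp_nat_mul]
  congr 1
  push_cast
  field_simp
  ring

/-- The Laplace transform `∫₀^∞ e^{-t} e^{itv} dt = (1 - iv)⁻¹`. -/
lemma integral_exp_neg_mul_exp_I_mul (v : ℝ) :
    ∫ t in Set.Ioi (0 : ℝ), Complex.exp (-t) * Complex.exp (Complex.I * t * v) =
      (1 - Complex.I * v)⁻¹ := by
  have hre : (-1 + Complex.I * v : ℂ).re < 0 := by simp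
  have := integral_exp_mul_complex_Ioi hre 0
  simp_rw [← Complex.exp_add]
  calc _ = ∫ t in Set.Ioi (0 : ℝ), Complex.exp ((-1 + Complex.I * v) * t) := by
        congr 1 with t
        ring_nf
    _ = _ := by
        rw [this, Complex.ofReal_zero, mul_zero, Complex.exp_zero, neg_div, ← div_neg, one_div]
        congr 1
        ring

/-- if `x ↦ e^{itu(x)}` is continuous for every `t` in a nontrivial
interval `[a, b]`, then `u` is continuous. -/
theorem stmt13 {X : Type*} [MetricSpace X] (u : X → ℝ) (a b : ℝ) (hab : a < b)
    (h : ∀ t ∈ Set.Icc a b, Continuous fun x => Complex.exp (Complex.I * t * u x)) :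
    Continuous u := by
  have hcont : Continuous fun x => ∫ t in Set.Ioi (0 : ℝ),
      Complex.exp (-t) * Complex.exp (Complex.I * t * u x) := by
    refine MeasureTheory.continuous_of_dominated (bound := fun t => Real.exp (-t)) ?_ ?_ ?_ ?_
    · intro x
      exact Continuous.aestronglyMeasurable (by fun_prop)
    · intro x
      refine Filter.Eventually.of_forall fun t => le_of_eq ?_
      simp [Complex.norm_exp]
    · exact integrableOn_exp_neg_Ioi 0
    · refine (MeasureTheory.ae_restrict_mem measurableSet_Ioi).mono fun t ht => ?_
      exact continuous_const.mul (continuous_exp_mul_of_Icc hab h (le_of_lt ht))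
  simp_rw [integral_exp_neg_mul_exp_I_mul] at hcont
  have hne : ∀ x, (1 - Complex.I * u x : ℂ)⁻¹ ≠ 0 := fun x =>
    inv_ne_zero fun h0 => by simpa using congrArg Complex.re h0
  exact (Complex.continuous_im.comp (hcont.inv₀ hne)).neg.congr fun x => by simp
end
end

section
/- Let (v_n) be a sequence of real numbers and let a < b be real numbers. If for every t ∈ [a, b] the sequence e^{itv_n} converges to 1 as n → ∞, then v_n → 0. -/
open Filter Topology

noncomputable section

lemma mul_integral_exp_I_mul (a b x : ℝ) :
    (Complex.I * x) * ∫ t in a..b, Complex.exp (Complex.I * t * x) =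
      Complex.exp (Complex.I * b * x) - Complex.exp (Complex.I * a * x) := by
  rw [← intervalIntegral.integral_const_mul]
  refine intervalIntegral.integral_eq_sub_of_hasDerivAt
    (f := fun t : ℝ => Complex.exp (Complex.I * t * x)) (fun t _ => ?_)
    (Continuous.intervalIntegrable (by fun_prop) _ _)
  have h := (((Complex.ofRealCLM.hasDerivAt (x := t)).const_mul Complex.I).mul_const (x : ℂ)).cexp
  simpa [mul_comm] using h

lemma norm_exp_I_mul_mul (t x : ℝ) : ‖Complex.exp (Complex.I * t * x)‖ = 1 := by
  rw [mul_assoc, mul_comm, ← Complex.ofReal_mul, Complex.norm_exp_ofReal_mul_I]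

lemma tendsto_integral_exp_I_mul (v : ℕ → ℝ) {a b : ℝ} (hab : a ≤ b)
    (h : ∀ t ∈ Set.Icc a b,
      Tendsto (fun n => Complex.exp (Complex.I * t * v n)) atTop (𝓝 1)) :
    Tendsto (fun n => ∫ t in a..b, Complex.exp (Complex.I * t * v n)) atTop
      (𝓝 ((b - a : ℝ) : ℂ)) := by
  have key := intervalIntegral.tendsto_integral_filter_of_dominated_convergence
    (μ := MeasureTheory.volume) (a := a) (b := b) (l := atTop)
    (F := fun (n : ℕ) (t : ℝ) => Complex.exp (Complex.I * t * v n)) (f := fun _ => (1 : ℂ))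
    (fun _ => (1 : ℝ))
    (Eventually.of_forall fun n => Continuous.aestronglyMeasurable (by fun_prop))
    (Eventually.of_forall fun n => Eventually.of_forall fun t _ =>
      (norm_exp_I_mul_mul t (v n)).le)
    intervalIntegrable_const
    (Eventually.of_forall fun t ht => h t <| by
      rw [Set.uIoc_of_le hab] at ht
      exact Set.Ioc_subset_Icc_self ht)
  simpa using key

/-- if `e^{itv_n} → 1` for every `t` in a nontrivial interval `[a, b]`,
then `v_n → 0`. -/
theorem stmt14 (v : ℕ → ℝ) (a b : ℝ) (hab : a < b)
    (h : ∀ t ∈ Set.Icc a b,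
      Tendsto (fun n => Complex.exp (Complex.I * t * v n)) atTop (𝓝 1)) :
    Tendsto v atTop (𝓝 0) := by
  have hne : ((b - a : ℝ) : ℂ) ≠ 0 := Complex.ofReal_ne_zero.2 (sub_pos.2 hab).ne'
  have hint := tendsto_integral_exp_I_mul v hab.le h
  have hquot := ((h b (Set.right_mem_Icc.2 hab.le)).sub
    (h a (Set.left_mem_Icc.2 hab.le))).div hint hne
  rw [sub_self, zero_div] at hquot
  have hIv : Tendsto (fun n => Complex.I * (v n : ℂ)) atTop (𝓝 0) := by
    refine hquot.congr' ?_
    filter_upwards [hint.eventually_ne hne] with n hn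
    rw [Pi.div_apply, ← mul_integral_exp_I_mul, mul_div_cancel_right₀ _ hn]
  rw [tendsto_zero_iff_norm_tendsto_zero] at hIv ⊢
  simpa using hIv
end
end
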